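/- Let Γ denote the Gamma function, let H ∈ (1/2, 1), set c_H = √(2H·Γ(3/2−H) / (Γ(1/2+H)·Γ(2−2H))), and for t ≥ 0 and q ∈ ℝ define the Mandelbrot–Van Ness kernel k_H(t, q) = c_H ( max(t−q, 0)^{H−1/2} − max(−q, 0)^{H−1/2} ). Then for all t, t' ≥ 0, the function q ↦ k_H(t, q) k_H(t', q) is integrable on ℝ and ∫_ℝ k_H(t, q) k_H(t', q) dq = (1/2) ( t^{2H} + t'^{2H} − |t − t'|^{2H} ). -/

import Mathlib

open Real MeasureTheory Set

noncomputable def cH (H : ℝ) : ℝ :=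
  Real.sqrt (2 * H * Real.Gamma (3/2 - H) / (Real.Gamma (1/2 + H) * Real.Gamma (2 - 2*H)))

noncomputable def kH (H t q : ℝ) : ℝ :=
  cH H * (max (t - q) 0 ^ (H - 1/2) - max (-q) 0 ^ (H - 1/2))

/-- Gamma integral as a lower integral. -/
lemma lint_gamma (a r : ℝ) (ha : 0 < a) (hr : 0 < r) :
    ∫⁻ x in Ioi (0:ℝ), ENNReal.ofReal (x ^ (a-1) * Real.exp (-(r*x)))
      = ENNReal.ofReal ((1/r)^a * Real.Gamma a) := by
  have h := Real.integral_rpow_mul_exp_neg_mul_Ioi ha hr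
  have hpos : 0 < (1/r)^a * Real.Gamma a :=
    mul_pos (Real.rpow_pos_of_pos (by positivity) _) (Real.Gamma_pos_of_pos ha)
  rw [← h]
  refine (ofReal_integral_eq_lintegral_ofReal ?_ ?_).symm
  · apply MeasureTheory.Integrable.of_integral_ne_zero
    rw [h]; exact hpos.ne'
  · refine (ae_restrict_iff' measurableSet_Ioi).2 (Filter.Eventually.of_forall fun x hx => ?_)
    have : (0:ℝ) < x := hx
    simp only [Pi.zero_apply]
    positivity

lemma lint_beta (a d : ℝ) (ha : 0 < a) (ha2 : a < 1/2) (hd : 0 < d) :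
    ∫⁻ x in Ioi (0:ℝ), ENNReal.ofReal (x ^ (a-1)) * ENNReal.ofReal ((x+d) ^ (a-1))
      = ENNReal.ofReal (Real.Gamma a * Real.Gamma (1-2*a) / Real.Gamma (1-a) * d ^ (2*a-1)) := by
  have hG : 0 < Real.Gamma (1-a) := Real.Gamma_pos_of_pos (by linarith)
  have hGa : 0 < Real.Gamma a := Real.Gamma_pos_of_pos ha
  have h1 : ∀ x ∈ Ioi (0:ℝ), ENNReal.ofReal (x ^ (a-1)) * ENNReal.ofReal ((x+d) ^ (a-1))
      = ∫⁻ s in Ioi (0:ℝ), ENNReal.ofReal ((Real.Gamma (1-a))⁻¹ * x ^ (a-1) *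
          (s ^ (1-a-1) * Real.exp (-((x+d)*s)))) := by
    intro x hx
    have hx0 : (0:ℝ) < x := hx
    have hc : 0 ≤ (Real.Gamma (1-a))⁻¹ * x ^ (a-1) := by positivity
    simp_rw [ENNReal.ofReal_mul hc]
    rw [lintegral_const_mul _ (by fun_prop), lint_gamma (1-a) (x+d) (by linarith) (by linarith),
      ← ENNReal.ofReal_mul hc, ← ENNReal.ofReal_mul (by positivity)]
    congr 1
    rw [one_div, Real.inv_rpow (by linarith), ← Real.rpow_neg (by linarith), neg_sub]
    field_simp
  rw [setLIntegral_congr_fun measurableSet_Ioi h1, lintegral_lintegral_swap (by fun_prop)]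
  have h2 : ∀ s ∈ Ioi (0:ℝ), ∫⁻ x in Ioi (0:ℝ), ENNReal.ofReal ((Real.Gamma (1-a))⁻¹ * x ^ (a-1) *
          (s ^ (1-a-1) * Real.exp (-((x+d)*s))))
      = ENNReal.ofReal ((Real.Gamma (1-a))⁻¹ * Real.Gamma a) *
        ENNReal.ofReal (s ^ (1-2*a-1) * Real.exp (-(d*s))) := by
    intro s hs
    have hs0 : (0:ℝ) < s := hs
    have e : ∀ x, (Real.Gamma (1-a))⁻¹ * x ^ (a-1) * (s ^ (1-a-1) * Real.exp (-((x+d)*s)))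
      = ((Real.Gamma (1-a))⁻¹ * s ^ (1-a-1) * Real.exp (-(d*s))) *
        (x ^ (a-1) * Real.exp (-(s*x))) := by
      intro x
      have : Real.exp (-((x+d)*s)) = Real.exp (-(d*s)) * Real.exp (-(s*x)) := by
        rw [← Real.exp_add]; congr 1; ring
      rw [this]; ring
    have hc : 0 ≤ (Real.Gamma (1-a))⁻¹ * s ^ (1-a-1) * Real.exp (-(d*s)) := by positivity
    simp_rw [e, ENNReal.ofReal_mul hc]
    rw [lintegral_const_mul _ (by fun_prop), lint_gamma a s ha hs0,
      ← ENNReal.ofReal_mul hc, ← ENNReal.ofReal_mul (by positivity)]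
    congr 1
    have : s ^ (1-2*a-1) = s ^ (1-a-1) * (1/s)^a := by
      rw [one_div, Real.inv_rpow hs0.le, ← Real.rpow_neg hs0.le, ← Real.rpow_add hs0]
      congr 1; ring
    rw [this]; ring
  rw [setLIntegral_congr_fun measurableSet_Ioi h2, lintegral_const_mul _ (by fun_prop),
    lint_gamma (1-2*a) d (by linarith) hd, ← ENNReal.ofReal_mul (by positivity)]
  congr 1
  rw [one_div, Real.inv_rpow hd.le, ← Real.rpow_neg hd.le, neg_sub]
  ring

/-- The one-sided power kernel. -/
noncomputable def pk (a x : ℝ) : ℝ := (Ioi (0:ℝ)).indicator (fun x => x ^ (a-1)) x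

lemma pk_nonneg (a x : ℝ) : 0 ≤ pk a x := by
  unfold pk
  exact indicator_nonneg (fun x hx => Real.rpow_nonneg (le_of_lt hx) _) x

@[fun_prop]
lemma pk_meas (a : ℝ) : Measurable (pk a) := by
  unfold pk
  exact (by fun_prop : Measurable (fun x : ℝ => x ^ (a-1))).indicator measurableSet_Ioi

lemma lint_pk_lt (a u v : ℝ) (ha : 0 < a) (ha2 : a < 1/2) (h : v < u) :
    ∫⁻ q, ENNReal.ofReal (pk a (u-q)) * ENNReal.ofReal (pk a (v-q))
      = ENNReal.ofReal (Real.Gamma a * Real.Gamma (1-2*a) / Real.Gamma (1-a) * |u-v| ^ (2*a-1)) := by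
  rw [abs_of_pos (sub_pos.2 h), ← lint_beta a (u-v) ha ha2 (sub_pos.2 h)]
  rw [← lintegral_sub_left_eq_self _ v, ← lintegral_indicator measurableSet_Ioi]
  congr 1
  ext x
  have e1 : u - (v - x) = x + (u - v) := by ring
  have e2 : v - (v - x) = x := by ring
  rw [e1, e2]
  by_cases hx : 0 < x
  · have hx2 : 0 < x + (u - v) := by linarith
    simp [pk, indicator, hx, hx2, mul_comm]
  · simp [pk, indicator, hx]

lemma lint_pk (a u v : ℝ) (ha : 0 < a) (ha2 : a < 1/2) (h : v ≠ u) :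
    ∫⁻ q, ENNReal.ofReal (pk a (u-q)) * ENNReal.ofReal (pk a (v-q))
      = ENNReal.ofReal (Real.Gamma a * Real.Gamma (1-2*a) / Real.Gamma (1-a) * |u-v| ^ (2*a-1)) := by
  rcases lt_or_gt_of_ne h with h | h
  · exact lint_pk_lt a u v ha ha2 h
  · rw [abs_sub_comm, ← lint_pk_lt a v u ha ha2 h]
    simp_rw [mul_comm]

lemma pk_int (a b : ℝ) (ha : 0 < a) :
    IntervalIntegrable (pk a) volume 0 b ∧ ∫ x in (0:ℝ)..b, pk a x = max b 0 ^ a / a := by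
  rcases le_total 0 b with hb | hb
  · have hc : ∀ x ∈ Set.uIoc (0:ℝ) b, x ^ (a-1) = pk a x := by
      intro x hx
      rw [uIoc_of_le hb] at hx
      simp [pk, indicator, hx.1]
    constructor
    · exact (intervalIntegral.intervalIntegrable_rpow' (by linarith)).congr hc
    · rw [intervalIntegral.integral_congr_ae (g := fun x => x ^ (a-1))
        (Filter.Eventually.of_forall fun x hx => (hc x hx).symm), integral_rpow (Or.inl (by linarith)),
        max_eq_left hb]
      simp [Real.zero_rpow ha.ne']
  · have hc : ∀ x ∈ Set.uIoc (0:ℝ) b, 0 = pk a x := by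
      intro x hx
      rw [uIoc_of_ge hb] at hx
      simp [pk, indicator, not_lt.2 hx.2]
    constructor
    · exact (intervalIntegrable_const (c := (0:ℝ))).congr hc
    · rw [intervalIntegral.integral_congr_ae (g := fun x => 0)
        (Filter.Eventually.of_forall fun x hx => (hc x hx).symm), max_eq_right hb]
      simp [Real.zero_rpow ha.ne']

/-- Unnormalized kernel. -/
noncomputable def fk (a t q : ℝ) : ℝ := max (t - q) 0 ^ a - max (-q) 0 ^ a

lemma fk_lint (a t q : ℝ) (ha : 0 < a) (ht : 0 ≤ t) :
    ENNReal.ofReal (fk a t q) = ∫⁻ u in Ioc 0 t, ENNReal.ofReal a * ENNReal.ofReal (pk a (u-q)) := by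
  have hi : IntervalIntegrable (pk a) volume (0-q) (t-q) :=
    ((pk_int a _ ha).1.symm).trans (pk_int a _ ha).1
  have h1 : fk a t q = a * ∫ u in (0:ℝ)..t, pk a (u-q) := by
    rw [intervalIntegral.integral_comp_sub_right (fun x => pk a x) q,
      ← intervalIntegral.integral_interval_sub_left (pk_int a _ ha).1 (pk_int a _ ha).1,
      (pk_int a _ ha).2, (pk_int a _ ha).2, fk, zero_sub]
    field_simp
  have hi2 : IntervalIntegrable (fun u => pk a (u-q)) volume 0 t := by
    have := hi.comp_sub_right q
    simpa using this
  rw [h1, ENNReal.ofReal_mul ha.le, lintegral_const_mul _ (by fun_prop),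
    intervalIntegral.integral_of_le ht, ofReal_integral_eq_lintegral_ofReal hi2.1
    (Filter.Eventually.of_forall fun x => pk_nonneg _ _)]

lemma fk_nonneg (a t q : ℝ) (ha : 0 < a) (ht : 0 ≤ t) : 0 ≤ fk a t q := by
  unfold fk
  have : max (-q) 0 ^ a ≤ max (t-q) 0 ^ a := by
    apply Real.rpow_le_rpow (le_max_right _ _) _ ha.le
    apply max_le_max _ le_rfl
    linarith
  linarith

lemma abs_int (b x : ℝ) (hb : -1 < b) (hx : 0 ≤ x) :
    IntervalIntegrable (fun v : ℝ => |v| ^ b) volume 0 x ∧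
      ∫ v in (0:ℝ)..x, |v| ^ b = x ^ (b+1) / (b+1) := by
  have hc : ∀ v ∈ Set.uIoc (0:ℝ) x, v ^ b = |v| ^ b := by
    intro v hv
    rw [uIoc_of_le hx] at hv
    rw [abs_of_pos hv.1]
  constructor
  · exact (intervalIntegral.intervalIntegrable_rpow' hb).congr hc
  · rw [intervalIntegral.integral_congr_ae (g := fun x => x ^ b)
        (Filter.Eventually.of_forall fun x hx => (hc x hx).symm), integral_rpow (Or.inl hb)]
    rw [Real.zero_rpow (by linarith), sub_zero]

lemma lint_abs (b t u : ℝ) (hb : -1 < b) (hu : u ∈ Ioc 0 t) :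
    ∫⁻ v in Ioc 0 t, ENNReal.ofReal (|u-v| ^ b)
      = ENNReal.ofReal ((u ^ (b+1) + (t-u)^(b+1)) / (b+1)) := by
  have ht : 0 ≤ t := hu.1.le.trans hu.2
  have A := abs_int b (t-u) hb (by linarith [hu.2])
  have B := abs_int b u hb hu.1.le
  have B1 : IntervalIntegrable (fun v : ℝ => |v| ^ b) volume (0-u) 0 := by
    have := (B.1.comp_sub_left 0).symm
    simpa using this
  have B2 : ∫ v in (0-u)..0, |v| ^ b = u ^ (b+1) / (b+1) := by
    rw [← B.2]
    have := intervalIntegral.integral_comp_neg (a := 0) (b := u) (fun v : ℝ => |v| ^ b)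
    simp only [abs_neg, neg_zero] at this
    rw [this, zero_sub]
  have hi : IntervalIntegrable (fun v => |u-v| ^ b) volume 0 t := by
    have := (B1.trans A.1).comp_sub_right u
    simpa [abs_sub_comm] using this
  rw [← ofReal_integral_eq_lintegral_ofReal hi.1
    (Filter.Eventually.of_forall fun x => by simp only [Pi.zero_apply]; positivity),
    ← intervalIntegral.integral_of_le ht]
  congr 1
  simp_rw [abs_sub_comm u]
  rw [intervalIntegral.integral_comp_sub_right (fun x => |x| ^ b) u,
    ← intervalIntegral.integral_add_adjacent_intervals B1 A.1, A.2, B2]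
  ring

lemma lint_abs2 (b t : ℝ) (hb : -1 < b) (ht : 0 ≤ t) :
    ∫⁻ u in Ioc 0 t, ∫⁻ v in Ioc 0 t, ENNReal.ofReal (|u-v| ^ b)
      = ENNReal.ofReal (2 * t ^ (b+2) / ((b+1)*(b+2))) := by
  rw [setLIntegral_congr_fun measurableSet_Ioc (fun u hu => lint_abs b t u hb hu)]
  have hb1 : 0 < b + 1 := by linarith
  have i1 : IntervalIntegrable (fun u : ℝ => u ^ (b+1)) volume 0 t :=
    intervalIntegral.intervalIntegrable_rpow' (by linarith)
  have i2 : IntervalIntegrable (fun u : ℝ => (t-u) ^ (b+1)) volume 0 t := by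
    have := (i1.comp_sub_left t).symm
    simpa using this
  rw [← ofReal_integral_eq_lintegral_ofReal ((i1.add i2).div_const _).1,
    ← intervalIntegral.integral_of_le ht]
  · congr 1
    rw [intervalIntegral.integral_div, intervalIntegral.integral_add i1 i2,
      intervalIntegral.integral_comp_sub_left (fun x => x ^ (b+1)) t, sub_self, sub_zero,
      integral_rpow (Or.inl (by linarith)), Real.zero_rpow (by linarith)]
    have : b + 1 + 1 = b + 2 := by ring
    rw [this]
    have : b + 2 ≠ 0 := by linarith
    field_simp
    ring
  · refine (ae_restrict_iff' measurableSet_Ioc).2 (Filter.Eventually.of_forall fun x hx => ?_)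
    have h1 : 0 ≤ x := hx.1.le
    have h2 : 0 ≤ t - x := by linarith [hx.2]
    simp only [Pi.zero_apply]
    positivity

noncomputable def CK (a : ℝ) : ℝ :=
  a ^ 2 * (Real.Gamma a * Real.Gamma (1-2*a) / Real.Gamma (1-a)) * (2 / ((2*a) * (2*a+1)))

lemma CK_pos (a : ℝ) (ha : 0 < a) (ha2 : a < 1/2) : 0 < CK a := by
  have h1 : 0 < Real.Gamma (1-a) := Real.Gamma_pos_of_pos (by linarith)
  have h2 : 0 < Real.Gamma a := Real.Gamma_pos_of_pos ha
  have h3 : 0 < Real.Gamma (1-2*a) := Real.Gamma_pos_of_pos (by linarith)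
  unfold CK
  positivity

lemma fk_lint_sq (a t : ℝ) (ha : 0 < a) (ha2 : a < 1/2) (ht : 0 ≤ t) :
    ∫⁻ q, ENNReal.ofReal (fk a t q ^ 2) = ENNReal.ofReal (CK a * t ^ (2*a+1)) := by
  have h1 : 0 < Real.Gamma (1-a) := Real.Gamma_pos_of_pos (by linarith)
  have h2 : 0 < Real.Gamma a := Real.Gamma_pos_of_pos ha
  have h3 : 0 < Real.Gamma (1-2*a) := Real.Gamma_pos_of_pos (by linarith)
  have e : ∀ q, ENNReal.ofReal (fk a t q ^ 2) = ∫⁻ u in Ioc 0 t, ∫⁻ v in Ioc 0 t,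
      ENNReal.ofReal a ^ 2 * (ENNReal.ofReal (pk a (u-q)) * ENNReal.ofReal (pk a (v-q))) := by
    intro q
    rw [sq, ENNReal.ofReal_mul (fk_nonneg a t q ha ht), fk_lint a t q ha ht,
      ← lintegral_mul_const _ (by fun_prop)]
    congr 1
    ext u
    rw [← lintegral_const_mul _ (by fun_prop)]
    congr 1
    ext v
    ring
  simp_rw [e]
  rw [lintegral_lintegral_swap (by
    apply Measurable.aemeasurable
    apply Measurable.lintegral_prod_right
    fun_prop)]
  have e2 : ∀ u, ∫⁻ q, ∫⁻ v in Ioc 0 t,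
      ENNReal.ofReal a ^ 2 * (ENNReal.ofReal (pk a (u-q)) * ENNReal.ofReal (pk a (v-q)))
      = ENNReal.ofReal (a ^ 2 * (Real.Gamma a * Real.Gamma (1-2*a) / Real.Gamma (1-a))) *
       ∫⁻ v in Ioc 0 t, ENNReal.ofReal (|u-v| ^ (2*a-1)) := by
    intro u
    rw [lintegral_lintegral_swap (by fun_prop), ← lintegral_const_mul _ (by fun_prop)]
    apply lintegral_congr_ae
    apply ae_restrict_of_ae
    have : ∀ᵐ v : ℝ, v ≠ u := by
      simp [ae_iff]
    filter_upwards [this] with v hv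
    rw [lintegral_const_mul _ (by fun_prop), lint_pk a u v ha ha2 hv,
      ENNReal.ofReal_mul (by positivity), ENNReal.ofReal_mul (by positivity),
      ENNReal.ofReal_pow ha.le, mul_assoc]
  simp_rw [e2]
  rw [lintegral_const_mul _ (by
    apply Measurable.lintegral_prod_right
    fun_prop), lint_abs2 _ _ (by linarith) ht, ← ENNReal.ofReal_mul (by positivity)]
  congr 1
  have r1 : 2*a-1+2 = 2*a+1 := by ring
  have r2 : 2*a-1+1 = 2*a := by ring
  rw [r1, r2, CK]
  ring

lemma fk_sq (a t : ℝ) (ha : 0 < a) (ha2 : a < 1/2) (ht : 0 ≤ t) :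
    Integrable (fun q => fk a t q ^ 2) ∧ ∫ q, fk a t q ^ 2 = CK a * t ^ (2*a+1) := by
  have hL := fk_lint_sq a t ha ha2 ht
  have hm : Measurable (fun q => fk a t q ^ 2) := by
    unfold fk
    fun_prop
  have hn : 0 ≤ᵐ[volume] (fun q => fk a t q ^ 2) :=
    Filter.Eventually.of_forall fun q => sq_nonneg _
  have hC := CK_pos a ha ha2
  constructor
  · refine ⟨hm.aestronglyMeasurable, ?_⟩
    rw [hasFiniteIntegral_iff_ofReal hn, hL]
    exact ENNReal.ofReal_lt_top
  · rw [integral_eq_lintegral_of_nonneg_ae hn hm.aestronglyMeasurable, hL,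
      ENNReal.toReal_ofReal (by positivity)]

lemma fk_cov (a t s : ℝ) (ha : 0 < a) (ha2 : a < 1/2) (hs : 0 ≤ s) (hst : s ≤ t) :
    Integrable (fun q => fk a t q * fk a s q) ∧ ∫ q, fk a t q * fk a s q
      = CK a * ((1/2) * (t ^ (2*a+1) + s ^ (2*a+1) - |t-s| ^ (2*a+1))) := by
  have A := fk_sq a t ha ha2 (hs.trans hst)
  have B := fk_sq a s ha ha2 hs
  have C := fk_sq a (t-s) ha ha2 (sub_nonneg.2 hst)
  have C1 := C.1.comp_sub_right s
  have AB : Integrable (fun q => fk a t q ^ 2 + fk a s q ^ 2) := A.1.add B.1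
  have C2 := integral_sub_right_eq_self (μ := volume) (fun q => fk a (t-s) q ^ 2) s
  have e : (fun q => fk a t q * fk a s q)
      = fun q => (1/2) * (fk a t q ^ 2 + fk a s q ^ 2 - fk a (t-s) (q-s) ^ 2) := by
    ext q
    have : fk a (t-s) (q-s) = fk a t q - fk a s q := by
      unfold fk
      rw [show t - s - (q-s) = t - q by ring, show -(q-s) = s - q by ring]
      ring
    rw [this]; ring
  rw [e]
  refine ⟨((A.1.add B.1).sub C1).const_mul _, ?_⟩
  rw [integral_const_mul, integral_sub AB C1, integral_add A.1 B.1, A.2, B.2, C2, C.2,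
    abs_of_nonneg (sub_nonneg.2 hst)]
  ring

lemma cH_sq (H : ℝ) (hH : H ∈ Set.Ioo (1/2 : ℝ) 1) : cH H ^ 2 * CK (H - 1/2) = 1 := by
  have h1 : 0 < Real.Gamma (3/2-H) := Real.Gamma_pos_of_pos (by linarith [hH.2])
  have h2 : 0 < Real.Gamma (H-1/2) := Real.Gamma_pos_of_pos (by linarith [hH.1])
  have h3 : 0 < Real.Gamma (2-2*H) := Real.Gamma_pos_of_pos (by linarith [hH.2])
  have h0 : 0 < H - 1/2 := by linarith [hH.1]
  have hH0 : 0 < H := by linarith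
  have h4 : Real.Gamma (1/2+H) = (H-1/2) * Real.Gamma (H-1/2) := by
    rw [← Real.Gamma_add_one h0.ne']; congr 1; ring
  unfold cH CK
  rw [h4, Real.sq_sqrt (by positivity), show 1 - (H-1/2) = 3/2-H by ring,
    show 1-2*(H-1/2) = 2-2*H by ring, show 2*(H-1/2)+1 = 2*H by ring]
  generalize H - 1/2 = a at *
  generalize Real.Gamma (3/2-H) = G1 at *
  generalize Real.Gamma (2-2*H) = G2 at *
  field_simp

theorem mvn_covariance (H : ℝ) (hH : H ∈ Set.Ioo (1/2 : ℝ) 1)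
    (t t' : ℝ) (ht : 0 ≤ t) (ht' : 0 ≤ t') :
    MeasureTheory.Integrable (fun q : ℝ => kH H t q * kH H t' q) ∧
    (∫ q : ℝ, kH H t q * kH H t' q)
      = (1/2) * (t ^ (2*H) + t' ^ (2*H) - |t - t'| ^ (2*H)) := by
  have key : ∀ t s : ℝ, 0 ≤ s → s ≤ t →
      MeasureTheory.Integrable (fun q : ℝ => kH H t q * kH H s q) ∧
      (∫ q : ℝ, kH H t q * kH H s q)
        = (1/2) * (t ^ (2*H) + s ^ (2*H) - |t - s| ^ (2*H)) := by
    intro t s hs hst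
    have h := fk_cov (H-1/2) t s (by linarith [hH.1]) (by linarith [hH.2]) hs hst
    have e : (fun q : ℝ => kH H t q * kH H s q)
        = fun q => cH H ^ 2 * (fk (H-1/2) t q * fk (H-1/2) s q) := by
      ext q
      unfold kH fk
      ring
    rw [e]
    refine ⟨h.1.const_mul _, ?_⟩
    rw [integral_const_mul, h.2, ← mul_assoc, cH_sq H hH, one_mul,
      show 2*(H-1/2)+1 = 2*H by ring]
  rcases le_total t' t with h | h
  · exact key t t' ht' h
  · have := key t' t ht h
    simp_rw [mul_comm (kH H t' _)] at this
    refine ⟨this.1, ?_⟩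
    rw [this.2, abs_sub_comm t t']
    ring
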